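/- Generalized CLT for the mean-field approximated clique count off the critical point (Theorem 3.12, first part): Fix an integer ℓ ≥ 3 and set C = ℓ(ℓ−1)/2. Assume α > −2, (α,h) ≠ (27/8, ln 2 − 3/2), that g_{α,h} attains its maximum over [0,1] at a unique point u₀* ∈ (0,1), and that c₀ := (1 − 2α(u₀*)²(1−u₀*))/(4u₀*(1−u₀*)) > 0. Let m̄_n^K(α,h) = Σ_{m∈Γ_n} m^C·ℙ̄_{n;α,h}({m}). Then the law of the random variable m ↦ n·(m^C − m̄_n^K(α,h))/√(ℓ!) under ℙ̄_{n;α,h} converges weakly, as n → ∞, to the centered Gaussian distribution with variance v̄^K = (C·(u₀*)^{C−1})²/(2·ℓ!·c₀). -/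

import Mathlib

open scoped Classical
open Filter MeasureTheory

/-- The edge density `2k/n²` corresponding to `k` edges out of `n(n−1)/2`. -/
noncomputable def mfDensity (n k : ℕ) : ℝ := 2 * k / (n : ℝ) ^ 2

/-- Mean-field Gibbs weight `𝒩_m · exp(n²((α/6)m³ + (h/2)m))` for `m = 2k/n²`. -/
noncomputable def mfWeight (α h : ℝ) (n k : ℕ) : ℝ :=
  (Nat.choose (n * (n - 1) / 2) k : ℝ) *
    Real.exp ((n : ℝ) ^ 2 * (α / 6 * (mfDensity n k) ^ 3 + h / 2 * mfDensity n k))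

/-- Mean-field partition function. -/
noncomputable def mfZ (α h : ℝ) (n : ℕ) : ℝ :=
  ∑ k ∈ Finset.range (n * (n - 1) / 2 + 1), mfWeight α h n k

/-- Expectation of `f(m)` under the mean-field Gibbs measure on edge densities `Γ_n`. -/
noncomputable def mfExp (α h : ℝ) (n : ℕ) (f : ℝ → ℝ) : ℝ :=
  (∑ k ∈ Finset.range (n * (n - 1) / 2 + 1), f (mfDensity n k) * mfWeight α h n k) /
    mfZ α h n

/-- Probability of the event `{m ∈ Γ_n : m ∈ A}` under the mean-field Gibbs measure. -/
noncomputable def mfProb (α h : ℝ) (n : ℕ) (A : Set ℝ) : ℝ :=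
  (∑ k ∈ Finset.range (n * (n - 1) / 2 + 1),
      if mfDensity n k ∈ A then mfWeight α h n k else 0) / mfZ α h n

/-- The energy function `g_{α,h}(u) = (α/6)u³ + (h/2)u − I(u)/2`
(note `Real.log 0 = 0`, so the boundary convention `I(0)=I(1)=0` is automatic). -/
noncomputable def gFun (α h u : ℝ) : ℝ :=
  α / 6 * u ^ 3 + h / 2 * u - (u * Real.log u + (1 - u) * Real.log (1 - u)) / 2

/-- The rescaled binomial coefficient `√N · C(N,k) · exp(N · I(k/N))`, where
`I(p) = p log p + (1-p) log (1-p)`. -/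
noncomputable def scaledChoose (N k : ℕ) : ℝ :=
  Real.sqrt N * (Nat.choose N k : ℝ) *
    Real.exp (N * ((k / N : ℝ) * Real.log (k / N) + (1 - k / N) * Real.log (1 - k / N)))

lemma exp_mul_log_nat (x : ℝ) (hx : 0 ≤ x) (k : ℕ) (hk : x = 0 → k = 0) :
    Real.exp (k * Real.log x) = x ^ k := by
  rcases hx.eq_or_lt with rfl | hx
  · simp [hk rfl]
  · rw [← Real.log_pow, Real.exp_log (by positivity)]

lemma exp_entropy_eq_pow {N k : ℕ} (hN : 0 < N) (hk : k ≤ N) :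
    Real.exp (N * ((k / N : ℝ) * Real.log (k / N) + (1 - k / N) * Real.log (1 - k / N)))
      = (k / N : ℝ) ^ k * (1 - k / N : ℝ) ^ (N - k) := by
  have hN' : (0 : ℝ) < N := by exact_mod_cast hN
  have hk' : (k : ℝ) ≤ N := by exact_mod_cast hk
  have h1 : (k / N : ℝ) ≤ 1 := by rw [div_le_one hN']; exact hk'
  rw [← exp_mul_log_nat (k / N : ℝ) (by positivity) k
      (fun h => by simpa [hN.ne'] using h),
    ← exp_mul_log_nat (1 - k / N : ℝ) (by linarith) (N - k) (fun h => by
      have h2 : (k : ℝ) = N := by field_simp at h; linarith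
      have h3 : k = N := by exact_mod_cast h2
      omega), ← Real.exp_add, Nat.cast_sub hk]
  congr 1
  field_simp

lemma scaledChoose_nonneg (N k : ℕ) : 0 ≤ scaledChoose N k := by
  unfold scaledChoose; positivity

lemma scaledChoose_le_sqrt {N k : ℕ} (hN : 0 < N) (hk : k ≤ N) :
    scaledChoose N k ≤ Real.sqrt N := by
  have hN' : (0 : ℝ) < N := by exact_mod_cast hN
  have hk' : (k : ℝ) ≤ N := by exact_mod_cast hk
  have h1 : (k / N : ℝ) ≤ 1 := by rw [div_le_one hN']; exact hk'
  have h0 : (0 : ℝ) ≤ 1 - k / N := by linarith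
  unfold scaledChoose
  rw [exp_entropy_eq_pow hN hk, mul_assoc]
  refine mul_le_of_le_one_right (by positivity) ?_
  have := add_pow (k / N : ℝ) (1 - k / N) N
  rw [add_sub_cancel, one_pow] at this
  refine le_trans (le_trans (le_of_eq ?_) (Finset.single_le_sum (f := fun m =>
    (k / N : ℝ) ^ m * (1 - k / N : ℝ) ^ (N - m) * (N.choose m : ℝ))
    (fun i _ => by positivity) (Finset.mem_range.2 (Nat.lt_succ_of_le hk)))) this.ge
  ring

/-- Stirling's formula for the rescaled binomial coefficient, as an exact identity. -/
lemma scaledChoose_eq_stirling {N k : ℕ} (hk : 0 < k) (hkN : k < N) :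
    scaledChoose N k = Stirling.stirlingSeq N /
      (Stirling.stirlingSeq k * Stirling.stirlingSeq (N - k)) /
        Real.sqrt (2 * ((k / N : ℝ) * (1 - k / N))) := by
  have hN : 0 < N := by omega
  obtain ⟨j, rfl⟩ : ∃ j, N = k + j := ⟨N - k, by omega⟩
  have hj : 0 < j := by omega
  unfold scaledChoose
  rw [exp_entropy_eq_pow hN hkN.le]
  have hk' : (0 : ℝ) < k := by exact_mod_cast hk
  have hj' : (0 : ℝ) < j := by exact_mod_cast hj
  have e1 : (1 - (k : ℝ) / ((k + j : ℕ) : ℝ)) = j / ((k + j : ℕ) : ℝ) := by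
    push_cast; field_simp; ring
  have e2 : (2 * ((k : ℝ) / ((k + j : ℕ) : ℝ) * (j / ((k + j : ℕ) : ℝ)))) =
      (2 * k) * (2 * j) / (2 * ((k + j : ℕ) : ℝ)) / ((k + j : ℕ) : ℝ) := by
    field_simp
  rw [e1, e2, Nat.add_sub_cancel_left, Real.sqrt_div (by positivity),
    Real.sqrt_div (by positivity), Real.sqrt_mul (by positivity),
    Nat.cast_add_choose]
  have hM : (0 : ℝ) < ((k + j : ℕ) : ℝ) := by positivity
  generalize hMd : ((k + j : ℕ) : ℝ) = M at *
  simp only [Stirling.stirlingSeq, hMd]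
  have hf1 : (0 : ℝ) < (k.factorial : ℝ) := by positivity
  have hf2 : (0 : ℝ) < (j.factorial : ℝ) := by positivity
  have s1 : 0 < Real.sqrt (2 * k) := by positivity
  have s2 : 0 < Real.sqrt (2 * j) := by positivity
  have s3 : 0 < Real.sqrt (2 * M) := by positivity
  have s4 : 0 < Real.sqrt M := by positivity
  have he : 0 < Real.exp 1 := by positivity
  simp only [div_pow, pow_add]
  field_simp

lemma stirlingSeq_pos {n : ℕ} (hn : 0 < n) : 0 < Stirling.stirlingSeq n :=
  lt_of_lt_of_le (by positivity) (Stirling.sqrt_pi_le_stirlingSeq hn.ne')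

lemma stirlingSeq_le_one {n : ℕ} (hn : 0 < n) :
    Stirling.stirlingSeq n ≤ Stirling.stirlingSeq 1 := by
  obtain ⟨m, rfl⟩ : ∃ m, n = m + 1 := ⟨n - 1, by omega⟩
  exact Stirling.stirlingSeq'_antitone (Nat.zero_le m)

lemma scaledChoose_le_of_mem {δ : ℝ} (hδ : 0 < δ) {N k : ℕ} (hN : 0 < N)
    (h1 : δ ≤ (k / N : ℝ)) (h2 : (k / N : ℝ) ≤ 1 - δ) :
    scaledChoose N k ≤ Stirling.stirlingSeq 1 / Real.pi / δ := by
  have hN' : (0 : ℝ) < N := by exact_mod_cast hN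
  have hk : 0 < k := by
    rcases Nat.eq_zero_or_pos k with rfl | h
    · simp at h1; linarith
    · exact h
  have hkN : k < N := by
    have : (k / N : ℝ) < 1 := by linarith
    rw [div_lt_one hN'] at this
    exact_mod_cast this
  rw [scaledChoose_eq_stirling hk hkN]
  have p1 := stirlingSeq_pos (Nat.one_pos)
  have a1 := Stirling.sqrt_pi_le_stirlingSeq hk.ne'
  have a2 := Stirling.sqrt_pi_le_stirlingSeq (n := N - k) (by omega)
  have hpi : Real.pi ≤ Stirling.stirlingSeq k * Stirling.stirlingSeq (N - k) := by
    calc Real.pi = Real.sqrt Real.pi * Real.sqrt Real.pi :=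
          (Real.mul_self_sqrt Real.pi_pos.le).symm
      _ ≤ _ := mul_le_mul a1 a2 (by positivity) (stirlingSeq_pos hk).le
  have hs : δ ≤ Real.sqrt (2 * ((k / N : ℝ) * (1 - k / N))) := by
    apply Real.le_sqrt_of_sq_le
    nlinarith
  have := Real.pi_pos
  have := stirlingSeq_le_one hN
  have := stirlingSeq_pos hN
  gcongr

lemma tendsto_scaledChoose {u : ℝ} (hu : u ∈ Set.Ioo (0 : ℝ) 1) {N k : ℕ → ℕ}
    (hN : Tendsto N atTop atTop)
    (hk : Tendsto (fun n => (k n / N n : ℝ)) atTop (nhds u)) :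
    Tendsto (fun n => scaledChoose (N n) (k n)) atTop
      (nhds (Real.sqrt (2 * Real.pi * (u * (1 - u))))⁻¹) := by
  obtain ⟨hu0, hu1⟩ := hu
  have hNr : Tendsto (fun n => (N n : ℝ)) atTop atTop :=
    tendsto_natCast_atTop_atTop.comp hN
  have hNpos : ∀ᶠ n in atTop, 0 < N n := hN.eventually_gt_atTop 0
  have hkt : Tendsto k atTop atTop := by
    rw [← tendsto_natCast_atTop_iff (R := ℝ)]
    refine (hk.pos_mul_atTop hu0 hNr).congr' ?_
    filter_upwards [hNpos] with n hn
    have : (0 : ℝ) < N n := by exact_mod_cast hn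
    field_simp
  have hlt : ∀ᶠ n in atTop, k n < N n := by
    filter_upwards [hNpos, hk.eventually_lt_const hu1] with n hn h
    have : (0 : ℝ) < N n := by exact_mod_cast hn
    rw [div_lt_one this] at h
    exact_mod_cast h
  have hjt : Tendsto (fun n => N n - k n) atTop atTop := by
    rw [← tendsto_natCast_atTop_iff (R := ℝ)]
    refine ((tendsto_const_nhds.sub hk).pos_mul_atTop (sub_pos.2 hu1) hNr).congr' ?_
    filter_upwards [hNpos, hlt] with n hn h
    have : (0 : ℝ) < N n := by exact_mod_cast hn
    rw [Nat.cast_sub h.le]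
    field_simp
  have hs := Stirling.tendsto_stirlingSeq_sqrt_pi
  have hlim := ((hs.comp hN).div ((hs.comp hkt).mul (hs.comp hjt)) (by positivity)).div
    ((hk.mul ((tendsto_const_nhds (x := (1 : ℝ))).sub hk)).const_mul 2).sqrt
    (Real.sqrt_ne_zero'.2 (by have := sub_pos.2 hu1; positivity))
  have e : (Real.sqrt (2 * Real.pi * (u * (1 - u))))⁻¹ =
      Real.sqrt Real.pi / (Real.sqrt Real.pi * Real.sqrt Real.pi) /
        Real.sqrt (2 * (u * (1 - u))) := by
    rw [mul_right_comm, Real.sqrt_mul (by have := sub_pos.2 hu1; positivity)]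
    have : 0 < Real.sqrt Real.pi := by positivity
    field_simp
  rw [e]
  refine hlim.congr' ?_
  filter_upwards [hlt, hkt.eventually_gt_atTop 0] with n h1 h2
  exact (scaledChoose_eq_stirling h2 h1).symm

lemma hasDerivAt_gFun (α h : ℝ) {u : ℝ} (hu : u ∈ Set.Ioo (0 : ℝ) 1) :
    HasDerivAt (gFun α h)
      (α / 2 * u ^ 2 + h / 2 - (Real.log u - Real.log (1 - u)) / 2) u := by
  have h0 : u ≠ 0 := hu.1.ne'
  have h1 : 1 - u ≠ 0 := (sub_pos.2 hu.2).ne'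
  have hid := hasDerivAt_id' u
  have hsub := hid.const_sub 1
  have := (((hid.pow 3).const_mul (α / 6)).add (hid.const_mul (h / 2))).sub
    (((hid.mul (hid.log h0)).add (hsub.mul (hsub.log h1))).div_const 2)
  refine this.congr_deriv ?_
  field_simp
  ring

lemma hasDerivAt_deriv_gFun (α h : ℝ) {u : ℝ} (hu : u ∈ Set.Ioo (0 : ℝ) 1) :
    HasDerivAt (fun u => α / 2 * u ^ 2 + h / 2 - (Real.log u - Real.log (1 - u)) / 2)
      (-2 * ((1 - 2 * α * u ^ 2 * (1 - u)) / (4 * u * (1 - u)))) u := by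
  have h0 : u ≠ 0 := hu.1.ne'
  have h1 : 1 - u ≠ 0 := (sub_pos.2 hu.2).ne'
  have hid := hasDerivAt_id' u
  have hsub := hid.const_sub 1
  have := (((hid.pow 2).const_mul (α / 2)).add_const (h / 2)).sub
    (((hid.log h0).sub (hsub.log h1)).div_const 2)
  refine this.congr_deriv ?_
  field_simp
  ring

/-- Second order Taylor expansion at a critical point. -/
lemma eventually_abs_sub_quadratic_le {f f' : ℝ → ℝ} {u c : ℝ}
    (hf : ∀ᶠ x in nhds u, HasDerivAt f (f' x) x) (hf0 : f' u = 0)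
    (hf' : HasDerivAt f' (-2 * c) u) {ε : ℝ} (hε : 0 < ε) :
    ∀ᶠ x in nhds u, |f x - f u + c * (x - u) ^ 2| ≤ ε * (x - u) ^ 2 := by
  have h1 := (hasDerivAt_iff_isLittleO.1 hf').def hε
  obtain ⟨δ, hδ, hball⟩ := Metric.eventually_nhds_iff.1 (hf.and h1)
  refine Metric.eventually_nhds_iff.2 ⟨δ, hδ, fun x hx => ?_⟩
  have hsub : ∀ y ∈ Set.uIcc u x, |y - u| ≤ |x - u| := fun y hy =>
    Set.abs_sub_left_of_mem_uIcc hy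
  have hd : ∀ y ∈ Set.uIcc u x, HasDerivWithinAt
      (fun y => f y - f u + c * (y - u) ^ 2) (f' y + 2 * c * (y - u)) (Set.uIcc u x) y := by
    intro y hy
    have hy' := (hball (y := y) (lt_of_le_of_lt (hsub y hy) hx)).1
    have := (hy'.sub_const (f u)).add ((((hasDerivAt_id' y).sub_const u).pow 2).const_mul c)
    refine (this.congr_deriv ?_).hasDerivWithinAt
    push_cast
    ring
  have hb : ∀ y ∈ Set.uIcc u x, ‖f' y + 2 * c * (y - u)‖ ≤ ε * |x - u| := by
    intro y hy
    have hy' := (hball (y := y) (lt_of_le_of_lt (hsub y hy) hx)).2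
    simp only [hf0, sub_zero, smul_eq_mul, Real.norm_eq_abs] at hy' ⊢
    calc |f' y + 2 * c * (y - u)| = |f' y - (y - u) * (-2 * c)| := by ring_nf
      _ ≤ ε * |y - u| := hy'
      _ ≤ _ := mul_le_mul_of_nonneg_left (hsub y hy) hε.le
  have := (convex_uIcc u x).norm_image_sub_le_of_norm_hasDerivWithin_le hd hb
    Set.left_mem_uIcc Set.right_mem_uIcc
  simpa [mul_assoc, ← sq, sq_abs] using this

lemma continuous_gFun (α h : ℝ) : Continuous (gFun α h) := by
  have h1 := Real.continuous_mul_log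
  have h2 : Continuous fun u : ℝ => (1 - u) * Real.log (1 - u) :=
    h1.comp (continuous_const.sub continuous_id)
  unfold gFun
  exact (by fun_prop : Continuous fun u : ℝ => α / 6 * u ^ 3 + h / 2 * u).sub
    ((h1.add h2).div_const 2)

lemma gFun_taylor {α h u₀ c₀ : ℝ} (hu₀ : u₀ ∈ Set.Ioo (0 : ℝ) 1)
    (hmax : ∀ u ∈ Set.Icc (0 : ℝ) 1, gFun α h u ≤ gFun α h u₀)
    (hc₀ : c₀ = (1 - 2 * α * u₀ ^ 2 * (1 - u₀)) / (4 * u₀ * (1 - u₀))) {ε : ℝ} (hε : 0 < ε) :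
    ∀ᶠ x in nhds u₀,
      |gFun α h x - gFun α h u₀ + c₀ * (x - u₀) ^ 2| ≤ ε * (x - u₀) ^ 2 := by
  have hn : Set.Ioo (0 : ℝ) 1 ∈ nhds u₀ := isOpen_Ioo.mem_nhds hu₀
  refine eventually_abs_sub_quadratic_le
    (by filter_upwards [hn] with x hx using hasDerivAt_gFun α h hx) ?_
    (hc₀ ▸ hasDerivAt_deriv_gFun α h hu₀) hε
  have hloc : IsLocalMax (gFun α h) u₀ := by
    filter_upwards [hn] with x hx using hmax x (Set.Ioo_subset_Icc_self hx)
  exact hloc.hasDerivAt_eq_zero (hasDerivAt_gFun α h hu₀)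

lemma exists_gFun_le_quadratic {α h u₀ c₀ : ℝ} (hu₀ : u₀ ∈ Set.Ioo (0 : ℝ) 1)
    (hmax : ∀ u ∈ Set.Icc (0 : ℝ) 1, gFun α h u ≤ gFun α h u₀)
    (huniq : ∀ u ∈ Set.Icc (0 : ℝ) 1, gFun α h u = gFun α h u₀ → u = u₀)
    (hc₀ : c₀ = (1 - 2 * α * u₀ ^ 2 * (1 - u₀)) / (4 * u₀ * (1 - u₀))) (hc₀pos : 0 < c₀) :
    ∃ c > 0, ∀ p ∈ Set.Icc (0 : ℝ) 1, gFun α h p - gFun α h u₀ ≤ -c * (p - u₀) ^ 2 := by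
  obtain ⟨δ, hδ, hball⟩ := Metric.eventually_nhds_iff.1
    (gFun_taylor hu₀ hmax hc₀ (half_pos hc₀pos))
  have hK : IsCompact (Set.Icc (0 : ℝ) 1 \ Metric.ball u₀ δ) :=
    isCompact_Icc.diff Metric.isOpen_ball
  obtain ⟨η, hη, hηle⟩ : ∃ η > 0, ∀ p ∈ Set.Icc (0 : ℝ) 1 \ Metric.ball u₀ δ,
      gFun α h p - gFun α h u₀ ≤ -η := by
    rcases (Set.Icc (0 : ℝ) 1 \ Metric.ball u₀ δ).eq_empty_or_nonempty with he | hne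
    · exact ⟨1, one_pos, by simp [he]⟩
    · obtain ⟨q, hq, hqm⟩ := hK.exists_isMaxOn hne (continuous_gFun α h).continuousOn
      refine ⟨gFun α h u₀ - gFun α h q, sub_pos.2 (lt_of_le_of_ne (hmax q hq.1) fun e => ?_),
        fun p hp => ?_⟩
      · apply hq.2
        rw [huniq q hq.1 e]
        exact Metric.mem_ball_self hδ
      · have : gFun α h p ≤ gFun α h q := hqm hp
        linarith
  refine ⟨min (c₀ / 2) η, lt_min (by linarith) hη, fun p hp => ?_⟩
  have hsq : (p - u₀) ^ 2 ≤ 1 := by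
    rw [sq_le_one_iff_abs_le_one, abs_le]
    constructor <;> linarith [hp.1, hp.2, hu₀.1, hu₀.2]
  have hm1 := min_le_left (c₀ / 2) η
  have hm2 := min_le_right (c₀ / 2) η
  have hs0 := sq_nonneg (p - u₀)
  by_cases hb : p ∈ Metric.ball u₀ δ
  · have := (abs_le.1 (hball hb)).2
    nlinarith [mul_le_mul_of_nonneg_right hm1 hs0]
  · have := hηle p ⟨hp, hb⟩
    nlinarith [mul_le_mul_of_nonneg_right hm2 hs0]

/-- The fraction of the `n(n−1)/2` possible edges that are present, centred at `u₀` and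
multiplied by `n`. -/
noncomputable def edgeFluct (u₀ : ℝ) (n k : ℕ) : ℝ :=
  n * (k / (n * (n - 1) / 2 : ℕ) - u₀)

/-- The Gibbs weight divided by a factor independent of `k`. -/
noncomputable def normWeight (α h u₀ : ℝ) (n k : ℕ) : ℝ :=
  scaledChoose (n * (n - 1) / 2) k *
    Real.exp (n * (n - 1) * (gFun α h (k / (n * (n - 1) / 2 : ℕ)) - gFun α h u₀)
      - α / 6 * ((n - 1) * (2 - 1 / n)) * ((k / (n * (n - 1) / 2 : ℕ) : ℝ) ^ 3 - u₀ ^ 3))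

lemma cast_card_edges {n : ℕ} (hn : 2 ≤ n) :
    ((n * (n - 1) / 2 : ℕ) : ℝ) = n * (n - 1) / 2 := by
  rw [Nat.cast_div (Nat.even_mul_pred_self n).two_dvd (by norm_num), Nat.cast_mul,
    Nat.cast_sub (by omega)]
  norm_num

lemma card_edges_pos {n : ℕ} (hn : 2 ≤ n) : 0 < n * (n - 1) / 2 :=
  Nat.div_pos (Nat.mul_le_mul hn (by omega : 1 ≤ n - 1)) (by norm_num)

lemma tendsto_card_edges : Tendsto (fun n : ℕ => n * (n - 1) / 2) atTop atTop := by
  refine tendsto_atTop_mono' atTop ?_ (tendsto_sub_atTop_nat 1)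
  filter_upwards [eventually_ge_atTop 2] with n hn
  rw [Nat.le_div_iff_mul_le (by norm_num), mul_comm]
  exact Nat.mul_le_mul_right _ hn

lemma exists_mfWeight_eq (α h u₀ : ℝ) {n : ℕ} (hn : 2 ≤ n) :
    ∃ D > 0, ∀ k, mfWeight α h n k = D * normWeight α h u₀ n k := by
  have hN0 : (0 : ℝ) < (n * (n - 1) / 2 : ℕ) := by exact_mod_cast card_edges_pos hn
  have hn2 : (2 : ℝ) ≤ n := by exact_mod_cast hn
  refine ⟨Real.exp (n * (n - 1) * gFun α h u₀ - α / 6 * ((n - 1) * (2 - 1 / n)) * u₀ ^ 3) /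
    Real.sqrt (n * (n - 1) / 2 : ℕ), by positivity, fun k => ?_⟩
  have hs : Real.sqrt (n * (n - 1) / 2 : ℕ) ≠ 0 := by positivity
  unfold mfWeight normWeight scaledChoose
  have hc := cast_card_edges hn
  have hm : mfDensity n k = (k / (n * (n - 1) / 2 : ℕ) : ℝ) * ((n - 1) / n) := by
    unfold mfDensity
    have : (n : ℝ) - 1 ≠ 0 := by linarith
    rw [hc]
    field_simp
  rw [hm]
  generalize (k / (n * (n - 1) / 2 : ℕ) : ℝ) = p
  have e : (n : ℝ) ^ 2 * (α / 6 * (p * ((n - 1) / n)) ^ 3 + h / 2 * (p * ((n - 1) / n))) =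
      (n * (n - 1) * gFun α h u₀ - α / 6 * ((n - 1) * (2 - 1 / n)) * u₀ ^ 3) +
      (((n * (n - 1) / 2 : ℕ) : ℝ) * (p * Real.log p + (1 - p) * Real.log (1 - p)) +
      (n * (n - 1) * (gFun α h p - gFun α h u₀)
        - α / 6 * ((n - 1) * (2 - 1 / n)) * (p ^ 3 - u₀ ^ 3))) := by
    rw [hc]
    unfold gFun
    field_simp
    ring
  rw [e, Real.exp_add, Real.exp_add]
  field_simp

lemma normWeight_nonneg (α h u₀ : ℝ) (n k : ℕ) : 0 ≤ normWeight α h u₀ n k :=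
  mul_nonneg (scaledChoose_nonneg _ _) (Real.exp_pos _).le

lemma edge_frac_mem {n k : ℕ} (hn : 2 ≤ n) (hk : k ≤ n * (n - 1) / 2) :
    (k / (n * (n - 1) / 2 : ℕ) : ℝ) ∈ Set.Icc (0 : ℝ) 1 := by
  have hN0 : (0 : ℝ) < (n * (n - 1) / 2 : ℕ) := by exact_mod_cast card_edges_pos hn
  exact ⟨by positivity, (div_le_one hN0).2 (by exact_mod_cast hk)⟩

lemma exists_scaledChoose_le {u₀ : ℝ} (hu₀ : u₀ ∈ Set.Ioo (0 : ℝ) 1) :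
    ∃ K > 0, ∀ n k : ℕ, 2 ≤ n → k ≤ n * (n - 1) / 2 →
      scaledChoose (n * (n - 1) / 2) k ≤ K * Real.exp |edgeFluct u₀ n k| := by
  obtain ⟨δ, hδ, h1, h2⟩ : ∃ δ > 0, 2 * δ ≤ u₀ ∧ 2 * δ ≤ 1 - u₀ :=
    ⟨min u₀ (1 - u₀) / 2, half_pos (lt_min hu₀.1 (sub_pos.2 hu₀.2)),
      by linarith [min_le_left u₀ (1 - u₀)], by linarith [min_le_right u₀ (1 - u₀)]⟩
  have hst := stirlingSeq_pos Nat.one_pos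
  have hpi := Real.pi_pos
  refine ⟨Stirling.stirlingSeq 1 / Real.pi / δ + 1 / δ, by positivity, fun n k hn hk => ?_⟩
  have hN := card_edges_pos hn
  have hn2 : (2 : ℝ) ≤ n := by exact_mod_cast hn
  have hexp := Real.add_one_le_exp |edgeFluct u₀ n k|
  have habs := abs_nonneg (edgeFluct u₀ n k)
  have hS : 0 < Stirling.stirlingSeq 1 / Real.pi / δ := by positivity
  have hδ' : 0 < 1 / δ := by positivity
  by_cases hp : δ ≤ (k / (n * (n - 1) / 2 : ℕ) : ℝ) ∧ (k / (n * (n - 1) / 2 : ℕ) : ℝ) ≤ 1 - δ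
  · have := scaledChoose_le_of_mem hδ hN hp.1 hp.2
    nlinarith
  · have hd : δ ≤ |(k / (n * (n - 1) / 2 : ℕ) : ℝ) - u₀| := by
      rw [le_abs]
      by_contra! hcon
      exact hp ⟨by linarith [hcon.2], by linarith [hcon.1]⟩
    have hx : (n : ℝ) * δ ≤ |edgeFluct u₀ n k| := by
      rw [edgeFluct, abs_mul, Nat.abs_cast]
      gcongr
    have hsq : Real.sqrt (n * (n - 1) / 2 : ℕ) ≤ n := by
      rw [Real.sqrt_le_left (by positivity), cast_card_edges hn]
      nlinarith
    calc _ ≤ (n : ℝ) := (scaledChoose_le_sqrt hN hk).trans hsq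
      _ = 1 / δ * (n * δ) := by field_simp
      _ ≤ 1 / δ * Real.exp |edgeFluct u₀ n k| := by gcongr; linarith
      _ ≤ _ := by gcongr; linarith

lemma exists_normWeight_le {α h u₀ c₀ : ℝ} (hu₀ : u₀ ∈ Set.Ioo (0 : ℝ) 1)
    (hmax : ∀ u ∈ Set.Icc (0 : ℝ) 1, gFun α h u ≤ gFun α h u₀)
    (huniq : ∀ u ∈ Set.Icc (0 : ℝ) 1, gFun α h u = gFun α h u₀ → u = u₀)
    (hc₀ : c₀ = (1 - 2 * α * u₀ ^ 2 * (1 - u₀)) / (4 * u₀ * (1 - u₀))) (hc₀pos : 0 < c₀) :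
    ∃ K > 0, ∃ b > 0, ∃ c > 0, ∀ n k : ℕ, 2 ≤ n → k ≤ n * (n - 1) / 2 →
      normWeight α h u₀ n k ≤
        K * Real.exp (b * |edgeFluct u₀ n k| - c * edgeFluct u₀ n k ^ 2) := by
  obtain ⟨c, hc, hg⟩ := exists_gFun_le_quadratic hu₀ hmax huniq hc₀ hc₀pos
  obtain ⟨K, hK, hB⟩ := exists_scaledChoose_le hu₀
  refine ⟨K, hK, 1 + |α|, by positivity, c / 2, half_pos hc, fun n k hn hk => ?_⟩
  have hn2 : (2 : ℝ) ≤ n := by exact_mod_cast hn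
  have hp := edge_frac_mem hn hk
  have hB' := hB n k hn hk
  have hg' := hg _ hp
  unfold normWeight
  refine (mul_le_mul_of_nonneg_right hB' (Real.exp_pos _).le).trans ?_
  rw [mul_assoc, ← Real.exp_add]
  refine mul_le_mul_of_nonneg_left (Real.exp_le_exp.2 ?_) hK.le
  unfold edgeFluct
  generalize (k / (n * (n - 1) / 2 : ℕ) : ℝ) = p at *
  have e1 : (n : ℝ) * (n - 1) * (gFun α h p - gFun α h u₀) ≤ -(c / 2) * (n * (p - u₀)) ^ 2 := by
    calc (n : ℝ) * (n - 1) * (gFun α h p - gFun α h u₀)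
        ≤ n * (n - 1) * (-c * (p - u₀) ^ 2) :=
          mul_le_mul_of_nonneg_left hg' (by nlinarith)
      _ ≤ _ := by
          have : 0 ≤ c * (p - u₀) ^ 2 := by positivity
          nlinarith [mul_nonneg this (by nlinarith : (0 : ℝ) ≤ n * (n - 1) - n ^ 2 / 2)]
  have e2 : |α / 6 * ((n - 1) * (2 - 1 / n)) * (p ^ 3 - u₀ ^ 3)| ≤ |α| * |n * (p - u₀)| := by
    have hfac : α / 6 * ((n - 1) * (2 - 1 / n)) * (p ^ 3 - u₀ ^ 3) =
        α * (n * (p - u₀)) * ((1 - 1 / n) * (2 - 1 / n) / 6 * (p ^ 2 + p * u₀ + u₀ ^ 2)) := by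
      field_simp
      ring
    have hinv : 1 / (n : ℝ) ≤ 1 / 2 := by gcongr
    have hinv0 : 0 ≤ 1 / (n : ℝ) := by positivity
    have hq0 : 0 ≤ p ^ 2 + p * u₀ + u₀ ^ 2 := by nlinarith [hp.1, hu₀.1, mul_nonneg hp.1 hu₀.1.le]
    have hq : p ^ 2 + p * u₀ + u₀ ^ 2 ≤ 3 := by
      nlinarith [hp.1, hu₀.1, hp.2, hu₀.2, mul_le_mul hp.2 hu₀.2.le hu₀.1.le zero_le_one]
    have hr0 : 0 ≤ (1 - 1 / (n : ℝ)) * (2 - 1 / n) :=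
      mul_nonneg (by linarith) (by linarith)
    have hr : (1 - 1 / (n : ℝ)) * (2 - 1 / n) ≤ 2 := by nlinarith
    rw [hfac, abs_mul, abs_mul α]
    refine mul_le_of_le_one_right (by positivity) ?_
    rw [abs_of_nonneg (by positivity)]
    have := mul_le_mul hr hq hq0 (by norm_num)
    linarith
  have := (abs_le.1 e2).1
  linarith

lemma tendsto_edge_frac {u₀ : ℝ} {k : ℕ → ℕ} {y : ℝ}
    (hk : Tendsto (fun n => edgeFluct u₀ n (k n)) atTop (nhds y)) :
    Tendsto (fun n => (k n / (n * (n - 1) / 2 : ℕ) : ℝ)) atTop (nhds u₀) := by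
  have := ((tendsto_one_div_atTop_nhds_zero_nat (𝕜 := ℝ)).mul hk).const_add u₀
  simp only [zero_mul, add_zero] at this
  refine this.congr' ?_
  filter_upwards [eventually_ge_atTop 1] with n hn
  have : (n : ℝ) ≠ 0 := by positivity
  unfold edgeFluct
  field_simp
  ring

lemma tendsto_normWeight {α h u₀ c₀ : ℝ} (hu₀ : u₀ ∈ Set.Ioo (0 : ℝ) 1)
    (hmax : ∀ u ∈ Set.Icc (0 : ℝ) 1, gFun α h u ≤ gFun α h u₀)
    (hc₀ : c₀ = (1 - 2 * α * u₀ ^ 2 * (1 - u₀)) / (4 * u₀ * (1 - u₀)))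
    {k : ℕ → ℕ} {y : ℝ} (hk : Tendsto (fun n => edgeFluct u₀ n (k n)) atTop (nhds y)) :
    Tendsto (fun n => normWeight α h u₀ n (k n)) atTop
      (nhds ((Real.sqrt (2 * Real.pi * (u₀ * (1 - u₀))))⁻¹ *
        Real.exp (-c₀ * y ^ 2 - α * u₀ ^ 2 * y))) := by
  have hinv : Tendsto (fun n : ℕ => 1 / (n : ℝ)) atTop (nhds 0) :=
    tendsto_one_div_atTop_nhds_zero_nat
  have hp := tendsto_edge_frac hk
  refine (tendsto_scaledChoose hu₀ tendsto_card_edges hp).mul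
    ((Real.continuous_exp.tendsto _).comp ?_)
  have h1 : Tendsto (fun n : ℕ => n * (n - 1) * (gFun α h (k n / (n * (n - 1) / 2 : ℕ)) -
      gFun α h u₀ + c₀ * ((k n / (n * (n - 1) / 2 : ℕ) : ℝ) - u₀) ^ 2)) atTop (nhds 0) := by
    rw [Metric.tendsto_nhds]
    intro ε hε
    have hy : 0 < ε / (y ^ 2 + 1) := by positivity
    filter_upwards [hp.eventually (gFun_taylor hu₀ hmax hc₀ hy), eventually_ge_atTop 1,
      (hk.pow 2).eventually_lt_const (lt_add_one _)] with n hn hn1 hyn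
    have hn1' : (1 : ℝ) ≤ n := by exact_mod_cast hn1
    unfold edgeFluct at hyn
    generalize (k n / (n * (n - 1) / 2 : ℕ) : ℝ) = p at *
    rw [dist_zero_right, Real.norm_eq_abs, abs_mul, abs_of_nonneg (by nlinarith)]
    calc _ ≤ n * (n - 1) * (ε / (y ^ 2 + 1) * (p - u₀) ^ 2) :=
          mul_le_mul_of_nonneg_left hn (by nlinarith)
      _ ≤ n * n * (ε / (y ^ 2 + 1) * (p - u₀) ^ 2) := by gcongr; linarith
      _ = ε / (y ^ 2 + 1) * (n * (p - u₀)) ^ 2 := by ring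
      _ < ε / (y ^ 2 + 1) * (y ^ 2 + 1) := by gcongr
      _ = ε := by field_simp
  have h2 := (((tendsto_const_nhds (x := (1 : ℝ))).sub hinv).mul (hk.pow 2)).const_mul c₀
  have h3 := (((((tendsto_const_nhds (x := (1 : ℝ))).sub hinv).mul
    ((tendsto_const_nhds (x := (2 : ℝ))).sub hinv)).const_mul (α / 6)).mul
      (hk.mul (((hp.pow 2).add (hp.mul_const u₀)).add_const (u₀ ^ 2))))
  have h4 := (h1.sub h2).sub h3
  have e : (0 - c₀ * ((1 - 0) * y ^ 2) - α / 6 * ((1 - 0) * (2 - 0)) *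
      (y * (u₀ ^ 2 + u₀ * u₀ + u₀ ^ 2))) = -c₀ * y ^ 2 - α * u₀ ^ 2 * y := by ring
  rw [e] at h4
  refine h4.congr' ?_
  filter_upwards [eventually_ge_atTop 1] with n hn
  have : (n : ℝ) ≠ 0 := by positivity
  unfold edgeFluct
  generalize (k n / (n * (n - 1) / 2 : ℕ) : ℝ) = p
  field_simp
  ring

lemma sum_range_eq_integral_floor (M : ℕ) (f : ℕ → ℝ) (hf : ∀ k, M ≤ k → f k = 0) :
    ∑ k ∈ Finset.range M, f k = ∫ t : ℝ, if 0 ≤ t then f ⌊t⌋₊ else 0 := by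
  have h1 : (fun t : ℝ => if 0 ≤ t then f ⌊t⌋₊ else 0) = fun t => ∑ k ∈ Finset.range M,
      (Set.Ico (k : ℝ) (k + 1)).indicator (fun _ => f k) t := by
    funext t
    split_ifs with ht
    · have hmem : ∀ k : ℕ, t ∈ Set.Ico (k : ℝ) (k + 1) ↔ k = ⌊t⌋₊ := fun k => by
        rw [eq_comm, Nat.floor_eq_iff ht, Set.mem_Ico]
      simp only [Set.indicator_apply, hmem, Finset.sum_ite_eq', Finset.mem_range]
      split_ifs with h
      · rfl
      · exact hf _ (not_lt.1 h)
    · refine (Finset.sum_eq_zero fun k _ => Set.indicator_of_notMem (fun h => ht ?_) _).symm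
      exact (Nat.cast_nonneg k).trans h.1
  rw [h1, integral_finsetSum]
  · refine Finset.sum_congr rfl fun k _ => ?_
    rw [integral_indicator_const _ measurableSet_Ico]
    simp [Measure.real]
  · intro k _
    rw [integrable_indicator_iff measurableSet_Ico]
    exact integrableOn_const (by simp)

lemma normWeight_eq_zero (α h u₀ : ℝ) {n k : ℕ} (hk : n * (n - 1) / 2 < k) :
    normWeight α h u₀ n k = 0 := by
  simp [normWeight, scaledChoose, Nat.choose_eq_zero_of_lt hk]

/-- The index whose rescaled position is just below `y`. -/
noncomputable def edgeIndex (u₀ y : ℝ) (n : ℕ) : ℕ :=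
  ⌊((n * (n - 1) / 2 : ℕ) : ℝ) * u₀ + ((n * (n - 1) / 2 : ℕ) : ℝ) / n * y⌋₊

lemma edgeFluct_edgeIndex {u₀ y : ℝ} {n : ℕ} (hn : 2 ≤ n)
    (ht : 0 ≤ ((n * (n - 1) / 2 : ℕ) : ℝ) * u₀ + ((n * (n - 1) / 2 : ℕ) : ℝ) / n * y) :
    |edgeFluct u₀ n (edgeIndex u₀ y n) - y| ≤ 2 / (n - 1) := by
  have hN0 : (0 : ℝ) < (n * (n - 1) / 2 : ℕ) := by exact_mod_cast card_edges_pos hn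
  have hn2 : (2 : ℝ) ≤ n := by exact_mod_cast hn
  have h1 := Nat.floor_le ht
  have h2 := Nat.lt_floor_add_one (((n * (n - 1) / 2 : ℕ) : ℝ) * u₀ +
    ((n * (n - 1) / 2 : ℕ) : ℝ) / n * y)
  change (edgeIndex u₀ y n : ℝ) ≤ _ at h1
  change _ < (edgeIndex u₀ y n : ℝ) + 1 at h2
  have hq : 2 / ((n : ℝ) - 1) = n / (n * (n - 1) / 2 : ℕ) := by
    have : (n : ℝ) - 1 ≠ 0 := by linarith
    rw [cast_card_edges hn]
    field_simp
  rw [hq]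
  unfold edgeFluct
  generalize ((n * (n - 1) / 2 : ℕ) : ℝ) = N at *
  have e : (n : ℝ) * (edgeIndex u₀ y n / N - u₀) - y =
      n / N * (edgeIndex u₀ y n - (N * u₀ + N / n * y)) := by
    field_simp
    ring
  rw [e, abs_mul, abs_of_nonneg (by positivity)]
  refine mul_le_of_le_one_right (by positivity) ?_
  rw [abs_le]
  constructor <;> linarith

lemma eventually_edge_pos {u₀ : ℝ} (hu₀ : 0 < u₀) (y : ℝ) :
    ∀ᶠ n : ℕ in atTop,
      0 ≤ ((n * (n - 1) / 2 : ℕ) : ℝ) * u₀ + ((n * (n - 1) / 2 : ℕ) : ℝ) / n * y := by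
  have h := (tendsto_one_div_atTop_nhds_zero_nat (𝕜 := ℝ)).mul_const y
  rw [zero_mul] at h
  filter_upwards [h.eventually_const_lt (neg_lt_zero.2 hu₀)] with n hn
  have : ((n * (n - 1) / 2 : ℕ) : ℝ) * u₀ + ((n * (n - 1) / 2 : ℕ) : ℝ) / n * y =
    ((n * (n - 1) / 2 : ℕ) : ℝ) * (u₀ + 1 / n * y) := by ring
  rw [this]
  exact mul_nonneg (Nat.cast_nonneg _) (by linarith)

lemma tendsto_edgeFluct_edgeIndex {u₀ : ℝ} (hu₀ : 0 < u₀) (y : ℝ) :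
    Tendsto (fun n => edgeFluct u₀ n (edgeIndex u₀ y n)) atTop (nhds y) := by
  rw [tendsto_iff_norm_sub_tendsto_zero]
  have h0 : Tendsto (fun n : ℕ => 2 / ((n : ℝ) - 1)) atTop (nhds 0) :=
    tendsto_const_nhds.div_atTop (tendsto_atTop_add_const_right _ _ tendsto_natCast_atTop_atTop)
  refine squeeze_zero' (Eventually.of_forall fun n => norm_nonneg _) ?_ h0
  filter_upwards [eventually_edge_pos hu₀ y, eventually_ge_atTop 2] with n h1 h2
  exact edgeFluct_edgeIndex h2 h1

lemma exp_gaussian_domination {b c x y : ℝ} (hc : 0 < c) (hxy : |x - y| ≤ 2) :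
    Real.exp (b * |x| - c * x ^ 2) ≤
      Real.exp (b ^ 2 / (2 * c) + 2 * c) * Real.exp (-(c / 4) * y ^ 2) := by
  rw [← Real.exp_add, Real.exp_le_exp]
  have h1 : b * |x| ≤ b ^ 2 / (2 * c) + c / 2 * x ^ 2 := by
    have h2 : 0 ≤ (b - c * |x|) ^ 2 / (2 * c) := by positivity
    have h3 : (b - c * |x|) ^ 2 / (2 * c) = b ^ 2 / (2 * c) - b * |x| + c / 2 * |x| ^ 2 := by
      field_simp
      ring
    rw [h3, sq_abs] at h2
    linarith
  have h4 : y ^ 2 ≤ 2 * x ^ 2 + 8 := by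
    have : (x - y) ^ 2 ≤ 4 := by
      have := sq_le_sq' (abs_le.1 hxy).1 (abs_le.1 hxy).2
      linarith
    nlinarith [sq_nonneg (2 * x - y)]
  nlinarith

/-- Laplace's method for sums against the rescaled Gibbs weights. -/
lemma tendsto_sum_normWeight {α h u₀ c₀ : ℝ} (hu₀ : u₀ ∈ Set.Ioo (0 : ℝ) 1)
    (hmax : ∀ u ∈ Set.Icc (0 : ℝ) 1, gFun α h u ≤ gFun α h u₀)
    (huniq : ∀ u ∈ Set.Icc (0 : ℝ) 1, gFun α h u = gFun α h u₀ → u = u₀)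
    (hc₀ : c₀ = (1 - 2 * α * u₀ ^ 2 * (1 - u₀)) / (4 * u₀ * (1 - u₀))) (hc₀pos : 0 < c₀)
    {a : ℕ → ℕ → ℝ} {A : ℝ → ℝ} {L : ℝ} (hL : 0 ≤ L)
    (hbound : ∀ n k : ℕ, 2 ≤ n → k ≤ n * (n - 1) / 2 →
      |a n k| ≤ L * Real.exp |edgeFluct u₀ n k|)
    (hlim : ∀ (y : ℝ) (k : ℕ → ℕ), Tendsto (fun n => edgeFluct u₀ n (k n)) atTop (nhds y) →
      Tendsto (fun n => a n (k n)) atTop (nhds (A y))) :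
    Tendsto (fun n : ℕ => |((n * (n - 1) / 2 : ℕ) : ℝ) / n|⁻¹ *
      ∑ k ∈ Finset.range (n * (n - 1) / 2 + 1), a n k * normWeight α h u₀ n k) atTop
      (nhds (∫ y : ℝ, A y * ((Real.sqrt (2 * Real.pi * (u₀ * (1 - u₀))))⁻¹ *
        Real.exp (-c₀ * y ^ 2 - α * u₀ ^ 2 * y)))) := by
  obtain ⟨K, hK, b, hb, c, hc, hW⟩ := exists_normWeight_le hu₀ hmax huniq hc₀ hc₀pos
  set F : ℕ → ℝ → ℝ := fun n y =>
    if 0 ≤ ((n * (n - 1) / 2 : ℕ) : ℝ) * u₀ + ((n * (n - 1) / 2 : ℕ) : ℝ) / n * y then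
      a n (edgeIndex u₀ y n) * normWeight α h u₀ n (edgeIndex u₀ y n) else 0 with hF
  have hsum : ∀ n : ℕ, |((n * (n - 1) / 2 : ℕ) : ℝ) / n|⁻¹ *
      ∑ k ∈ Finset.range (n * (n - 1) / 2 + 1), a n k * normWeight α h u₀ n k =
        ∫ y, F n y := by
    intro n
    rw [sum_range_eq_integral_floor _ _ fun k hk => by
      rw [normWeight_eq_zero α h u₀ (Nat.lt_of_succ_le hk), mul_zero]]
    rw [← integral_add_left_eq_self _ (((n * (n - 1) / 2 : ℕ) : ℝ) * u₀)]
    rw [← abs_inv, ← smul_eq_mul, ← Measure.integral_comp_mul_left]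
    rfl
  simp_rw [hsum]
  refine tendsto_integral_filter_of_dominated_convergence
    (fun y => L * K * Real.exp ((b + 1) ^ 2 / (2 * c) + 2 * c) * Real.exp (-(c / 4) * y ^ 2))
    (Eventually.of_forall fun n => ?_) ?_ ?_ ?_
  · have hm : Measurable fun y : ℝ =>
        ((n * (n - 1) / 2 : ℕ) : ℝ) * u₀ + ((n * (n - 1) / 2 : ℕ) : ℝ) / n * y := by fun_prop
    refine (Measurable.ite (measurableSet_le measurable_const hm) ?_
      measurable_const).aestronglyMeasurable
    exact (measurable_of_countable fun k : ℕ => a n k * normWeight α h u₀ n k).comp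
      (Nat.measurable_floor.comp hm)
  · filter_upwards [eventually_ge_atTop 2] with n hn
    refine Eventually.of_forall fun y => ?_
    have hn2 : (2 : ℝ) ≤ n := by exact_mod_cast hn
    simp only [hF]
    split_ifs with ht
    · rcases lt_or_ge (n * (n - 1) / 2) (edgeIndex u₀ y n) with hk | hk
      · rw [normWeight_eq_zero α h u₀ hk, mul_zero, norm_zero]
        positivity
      · have hd := edgeFluct_edgeIndex hn ht
        have hd2 : (2 : ℝ) / (n - 1) ≤ 2 := by
          rw [div_le_iff₀ (by linarith)]
          linarith
        have hdom := exp_gaussian_domination (b := b + 1) hc (hd.trans hd2)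
        rw [norm_mul, Real.norm_eq_abs, Real.norm_eq_abs,
          abs_of_nonneg (normWeight_nonneg _ _ _ _ _)]
        calc _ ≤ (L * Real.exp |edgeFluct u₀ n (edgeIndex u₀ y n)|) *
              (K * Real.exp (b * |edgeFluct u₀ n (edgeIndex u₀ y n)| -
                c * edgeFluct u₀ n (edgeIndex u₀ y n) ^ 2)) :=
              mul_le_mul (hbound n _ hn hk) (hW n _ hn hk) (normWeight_nonneg _ _ _ _ _)
                (by positivity)
          _ = L * K * Real.exp ((b + 1) * |edgeFluct u₀ n (edgeIndex u₀ y n)| -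
                c * edgeFluct u₀ n (edgeIndex u₀ y n) ^ 2) := by
              rw [mul_mul_mul_comm, ← Real.exp_add]
              congr 2
              ring
          _ ≤ _ := by
              rw [mul_assoc (L * K)]
              exact mul_le_mul_of_nonneg_left hdom (by positivity)
    · rw [norm_zero]
      positivity
  · exact (integrable_exp_neg_mul_sq (by linarith)).const_mul _
  · refine Eventually.of_forall fun y => ?_
    have hx := tendsto_edgeFluct_edgeIndex hu₀.1 y
    refine ((hlim y _ hx).mul (tendsto_normWeight hu₀ hmax hc₀ hx)).congr' ?_
    filter_upwards [eventually_edge_pos hu₀.1 y] with n hn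
    simp only [hF, if_pos hn]

lemma integral_mul_exp_quadratic (A : ℝ → ℝ) {c₀ : ℝ} (hc₀ : 0 < c₀) (s b : ℝ) :
    ∫ y : ℝ, A y * (s * Real.exp (-c₀ * y ^ 2 - b * y)) =
      s * Real.exp (b ^ 2 / (4 * c₀)) *
        ∫ y : ℝ, A (y - b / (2 * c₀)) * Real.exp (-c₀ * y ^ 2) := by
  rw [← integral_sub_right_eq_self _ (b / (2 * c₀)), ← integral_const_mul]
  congr 1
  funext y
  have : -c₀ * (y - b / (2 * c₀)) ^ 2 - b * (y - b / (2 * c₀)) =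
      b ^ 2 / (4 * c₀) + -c₀ * y ^ 2 := by
    field_simp
    ring
  rw [this, Real.exp_add]
  ring

lemma mfZ_pos (α h : ℝ) (n : ℕ) : 0 < mfZ α h n := by
  refine Finset.sum_pos (fun k hk => ?_) (by simp)
  have := Nat.choose_pos (Nat.lt_succ_iff.1 (Finset.mem_range.1 hk))
  unfold mfWeight
  positivity

/-- Limits of expectations of observables of the rescaled edge fluctuation. -/
lemma tendsto_mfExp {α h u₀ c₀ : ℝ} (hu₀ : u₀ ∈ Set.Ioo (0 : ℝ) 1)
    (hmax : ∀ u ∈ Set.Icc (0 : ℝ) 1, gFun α h u ≤ gFun α h u₀)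
    (huniq : ∀ u ∈ Set.Icc (0 : ℝ) 1, gFun α h u = gFun α h u₀ → u = u₀)
    (hc₀ : c₀ = (1 - 2 * α * u₀ ^ 2 * (1 - u₀)) / (4 * u₀ * (1 - u₀))) (hc₀pos : 0 < c₀)
    {f : ℕ → ℝ → ℝ} {A : ℝ → ℝ} {L : ℝ} (hL : 0 ≤ L)
    (hbound : ∀ n k : ℕ, 2 ≤ n → k ≤ n * (n - 1) / 2 →
      |f n (mfDensity n k)| ≤ L * Real.exp |edgeFluct u₀ n k|)
    (hlim : ∀ (y : ℝ) (k : ℕ → ℕ), Tendsto (fun n => edgeFluct u₀ n (k n)) atTop (nhds y) →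
      Tendsto (fun n => f n (mfDensity n (k n))) atTop (nhds (A y))) :
    Tendsto (fun n => mfExp α h n (f n)) atTop
      (nhds ((∫ y : ℝ, A (y - α * u₀ ^ 2 / (2 * c₀)) * Real.exp (-c₀ * y ^ 2)) /
        Real.sqrt (Real.pi / c₀))) := by
  have hnum := tendsto_sum_normWeight hu₀ hmax huniq hc₀ hc₀pos hL hbound hlim
  have hden := tendsto_sum_normWeight hu₀ hmax huniq hc₀ hc₀pos (a := fun _ _ => 1)
    (A := fun _ => 1) zero_le_one (fun n k _ _ => by simp)
    (fun _ _ _ => tendsto_const_nhds)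
  rw [integral_mul_exp_quadratic _ hc₀pos] at hnum hden
  have hs : 0 < (Real.sqrt (2 * Real.pi * (u₀ * (1 - u₀))))⁻¹ := by
    have := hu₀.1
    have := sub_pos.2 hu₀.2
    positivity
  have he := Real.exp_pos ((α * u₀ ^ 2) ^ 2 / (4 * c₀))
  have hg : 0 < Real.sqrt (Real.pi / c₀) := by positivity
  simp only [one_mul] at hden
  rw [integral_gaussian] at hden
  have hq := hnum.div hden (by positivity)
  rw [mul_div_mul_left _ _ (by positivity)] at hq
  refine hq.congr' ?_
  filter_upwards [eventually_ge_atTop 2] with n hn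
  obtain ⟨D, hD, hw⟩ := exists_mfWeight_eq α h u₀ hn
  have hN0 : (0 : ℝ) < (n * (n - 1) / 2 : ℕ) := by exact_mod_cast card_edges_pos hn
  have hn0 : (0 : ℝ) < n := by positivity
  have hpos : |((n * (n - 1) / 2 : ℕ) : ℝ) / n|⁻¹ ≠ 0 := by positivity
  simp only [Pi.div_apply]
  rw [mul_div_mul_left _ _ hpos, mfExp, mfZ]
  simp_rw [hw, mul_left_comm _ D, ← Finset.mul_sum]
  rw [mul_div_mul_left _ _ hD.ne']

lemma mfDensity_eq {n : ℕ} (hn : 2 ≤ n) (k : ℕ) :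
    mfDensity n k = (1 - 1 / n) * (k / (n * (n - 1) / 2 : ℕ) : ℝ) := by
  have hn2 : (2 : ℝ) ≤ n := by exact_mod_cast hn
  have : (n : ℝ) - 1 ≠ 0 := by linarith
  unfold mfDensity
  rw [cast_card_edges hn]
  field_simp

lemma mul_mfDensity_sub {n : ℕ} (hn : 2 ≤ n) (k : ℕ) (u₀ : ℝ) :
    n * (mfDensity n k - u₀) = edgeFluct u₀ n k - (k / (n * (n - 1) / 2 : ℕ) : ℝ) := by
  have hn2 : (2 : ℝ) ≤ n := by exact_mod_cast hn
  rw [mfDensity_eq hn, edgeFluct]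
  field_simp
  ring

lemma tendsto_mfDensity {u₀ : ℝ} {k : ℕ → ℕ} {y : ℝ}
    (hk : Tendsto (fun n => edgeFluct u₀ n (k n)) atTop (nhds y)) :
    Tendsto (fun n => mfDensity n (k n)) atTop (nhds u₀) := by
  have := ((tendsto_one_div_atTop_nhds_zero_nat (𝕜 := ℝ)).const_sub 1).mul (tendsto_edge_frac hk)
  rw [sub_zero, one_mul] at this
  refine this.congr' ?_
  filter_upwards [eventually_ge_atTop 2] with n hn using (mfDensity_eq hn _).symm

lemma tendsto_pow_mfDensity {u₀ : ℝ} (C : ℕ) {k : ℕ → ℕ} {y : ℝ}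
    (hk : Tendsto (fun n => edgeFluct u₀ n (k n)) atTop (nhds y)) :
    Tendsto (fun n : ℕ => n * (mfDensity n (k n) ^ C - u₀ ^ C)) atTop
      (nhds (C * u₀ ^ (C - 1) * (y - u₀))) := by
  have hm := tendsto_mfDensity hk
  have hs : Tendsto (fun n => ∑ i ∈ Finset.range C, mfDensity n (k n) ^ i * u₀ ^ (C - 1 - i))
      atTop (nhds (∑ i ∈ Finset.range C, u₀ ^ i * u₀ ^ (C - 1 - i))) :=
    tendsto_finsetSum _ fun i _ => (hm.pow i).mul_const _
  rw [geom_sum₂_self] at hs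
  refine (hs.mul (hk.sub (tendsto_edge_frac hk))).congr' ?_
  filter_upwards [eventually_ge_atTop 2] with n hn
  rw [← mul_mfDensity_sub hn, ← geom_sum₂_mul]
  ring

lemma abs_pow_mfDensity_le {u₀ : ℝ} (hu₀ : u₀ ∈ Set.Ioo (0 : ℝ) 1) (C : ℕ) {n k : ℕ}
    (hn : 2 ≤ n) (hk : k ≤ n * (n - 1) / 2) :
    |n * (mfDensity n k ^ C - u₀ ^ C)| ≤ C * Real.exp |edgeFluct u₀ n k| := by
  have hp := edge_frac_mem hn hk
  have hn2 : (2 : ℝ) ≤ n := by exact_mod_cast hn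
  have hinv : 1 / (n : ℝ) ≤ 1 := by rw [div_le_one (by linarith)]; linarith
  have hinv0 : 0 ≤ 1 / (n : ℝ) := by positivity
  have hm0 : 0 ≤ mfDensity n k := by unfold mfDensity; positivity
  have hm1 : mfDensity n k ≤ 1 := by
    rw [mfDensity_eq hn]
    exact mul_le_one₀ (by linarith) hp.1 hp.2
  rw [← geom_sum₂_mul, mul_left_comm, mul_mfDensity_sub hn, abs_mul]
  refine mul_le_mul ?_ ?_ (abs_nonneg _) (Nat.cast_nonneg _)
  · rw [abs_of_nonneg (Finset.sum_nonneg fun i _ => mul_nonneg (pow_nonneg hm0 _)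
      (pow_nonneg hu₀.1.le _))]
    calc _ ≤ ∑ i ∈ Finset.range C, (1 : ℝ) := Finset.sum_le_sum fun i _ =>
          mul_le_one₀ (pow_le_one₀ hm0 hm1) (pow_nonneg hu₀.1.le _)
            (pow_le_one₀ hu₀.1.le hu₀.2.le)
      _ = C := by simp
  · have h1 := abs_sub (edgeFluct u₀ n k) (k / (n * (n - 1) / 2 : ℕ) : ℝ)
    rw [abs_of_nonneg hp.1] at h1
    linarith [hp.2, Real.add_one_le_exp |edgeFluct u₀ n k|]

lemma mfExp_const_mul_sub (α h : ℝ) (n : ℕ) (r s : ℝ) (f : ℝ → ℝ) :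
    mfExp α h n (fun m => r * (f m - s)) = r * (mfExp α h n f - s) := by
  have hZ := (mfZ_pos α h n).ne'
  unfold mfExp
  simp_rw [mul_assoc, sub_mul, ← Finset.mul_sum, Finset.sum_sub_distrib, ← Finset.mul_sum]
  change r * (_ - s * mfZ α h n) / mfZ α h n = _
  field_simp

lemma integral_affine_mul_gaussian {c : ℝ} (hc : 0 < c) (r s : ℝ) :
    (∫ y : ℝ, r * (y + s) * Real.exp (-c * y ^ 2)) / Real.sqrt (Real.pi / c) = r * s := by
  have hodd : ∫ y : ℝ, y * Real.exp (-c * y ^ 2) = 0 := by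
    have h := integral_neg_eq_self (fun y : ℝ => y * Real.exp (-c * y ^ 2)) volume
    simp only [neg_sq, neg_mul, integral_neg] at h ⊢
    linarith
  have hg : Real.sqrt (Real.pi / c) ≠ 0 := by positivity
  have e : ∀ y : ℝ, r * (y + s) * Real.exp (-c * y ^ 2) =
      r * (y * Real.exp (-c * y ^ 2)) + r * s * Real.exp (-c * y ^ 2) := fun y => by ring
  simp_rw [e]
  rw [integral_add ((integrable_mul_exp_neg_mul_sq hc).const_mul _)
    ((integrable_exp_neg_mul_sq hc).const_mul _), integral_const_mul, integral_const_mul,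
    hodd, integral_gaussian, mul_zero, zero_add, mul_div_assoc, div_self hg, mul_one]

lemma integral_comp_mul_gaussian (φ : ℝ → ℝ) {c κ v : ℝ} (hc : 0 < c) (hκ : 0 < κ)
    (hv : v = κ ^ 2 / (2 * c)) :
    (∫ y : ℝ, φ (κ * y) * Real.exp (-c * y ^ 2)) / Real.sqrt (Real.pi / c) =
      ∫ y : ℝ, φ y * ((Real.sqrt (2 * Real.pi * v))⁻¹ * Real.exp (-(y ^ 2) / (2 * v))) := by
  have h := Measure.integral_comp_mul_left
    (fun z : ℝ => φ z * Real.exp (-(z ^ 2) / (2 * v))) κ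
  have e1 : ∀ y : ℝ, -((κ * y) ^ 2) / (2 * v) = -c * y ^ 2 := fun y => by
    rw [hv]
    field_simp
  have e2 : Real.sqrt (2 * Real.pi * v) = κ * Real.sqrt (Real.pi / c) := by
    have : 2 * Real.pi * v = κ ^ 2 * (Real.pi / c) := by
      rw [hv]
      field_simp
    rw [this, Real.sqrt_mul (by positivity), Real.sqrt_sq hκ.le]
  simp_rw [e1] at h
  rw [h, e2, abs_of_pos (by positivity), smul_eq_mul]
  simp_rw [mul_left_comm (φ _)]
  rw [integral_const_mul, mul_inv]
  ring

/-- Generalized CLT for the mean-field approximated clique count off the critical point: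
the law of `n·(m^C − m̄_n^K)/√(ℓ!)` converges weakly to
`𝒩(0, (C·(u₀*)^{C−1})²/(2·ℓ!·c₀))`, where `C = ℓ(ℓ−1)/2`. -/
theorem meanField_clique_CLT_off_critical
    (ℓ : ℕ) (hℓ : 3 ≤ ℓ)
    (α h : ℝ) (hα : α > -2) (hne : (α, h) ≠ ((27 : ℝ) / 8, Real.log 2 - 3 / 2))
    (u₀ : ℝ) (hu₀ : u₀ ∈ Set.Ioo (0 : ℝ) 1)
    (hmax : ∀ u ∈ Set.Icc (0 : ℝ) 1, gFun α h u ≤ gFun α h u₀)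
    (huniq : ∀ u ∈ Set.Icc (0 : ℝ) 1, gFun α h u = gFun α h u₀ → u = u₀)
    (c₀ v : ℝ)
    (hc₀ : c₀ = (1 - 2 * α * u₀ ^ 2 * (1 - u₀)) / (4 * u₀ * (1 - u₀)))
    (hc₀pos : 0 < c₀)
    (hv : v = ((ℓ * (ℓ - 1) / 2 : ℕ) * u₀ ^ (ℓ * (ℓ - 1) / 2 - 1)) ^ 2 /
      (2 * (Nat.factorial ℓ : ℝ) * c₀)) :
    ∀ φ : ℝ → ℝ, Continuous φ → (∃ M : ℝ, ∀ x, |φ x| ≤ M) →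
      Tendsto
        (fun n : ℕ => mfExp α h n
          (fun m => φ ((n : ℝ) *
            (m ^ (ℓ * (ℓ - 1) / 2) - mfExp α h n (fun m' => m' ^ (ℓ * (ℓ - 1) / 2))) /
            Real.sqrt (Nat.factorial ℓ))))
        atTop
        (nhds (∫ y : ℝ,
          φ y * ((Real.sqrt (2 * Real.pi * v))⁻¹ * Real.exp (-(y ^ 2) / (2 * v))))) := by
  rintro φ hφ ⟨M, hM⟩
  set C := ℓ * (ℓ - 1) / 2
  have hCpos : (0 : ℝ) < C := by exact_mod_cast card_edges_pos (by omega : 2 ≤ ℓ)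
  have hfac : (0 : ℝ) < Real.sqrt (Nat.factorial ℓ) := by positivity
  have hu0 := hu₀.1
  have hmean := tendsto_mfExp hu₀ hmax huniq hc₀ hc₀pos
    (f := fun n m => n * (m ^ C - u₀ ^ C)) (Nat.cast_nonneg C)
    (fun n k hn hk => abs_pow_mfDensity_le hu₀ C hn hk) (fun y k hk => tendsto_pow_mfDensity C hk)
  simp only [sub_sub, mfExp_const_mul_sub] at hmean
  simp only [sub_eq_add_neg] at hmean
  rw [integral_affine_mul_gaussian hc₀pos] at hmean
  have hclt := tendsto_mfExp hu₀ hmax huniq hc₀ hc₀pos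
    (f := fun n m => φ ((n : ℝ) * (m ^ C - mfExp α h n (fun m' => m' ^ C)) /
      Real.sqrt (Nat.factorial ℓ)))
    (A := fun y => φ (C * u₀ ^ (C - 1) / Real.sqrt (Nat.factorial ℓ) *
      (y + α * u₀ ^ 2 / (2 * c₀)))) (L := M)
    ((abs_nonneg _).trans (hM 0))
    (fun n k _ _ => (hM _).trans (le_mul_of_one_le_right ((abs_nonneg _).trans (hM 0))
      (Real.one_le_exp (abs_nonneg _))))
    (fun y k hk => ?_)
  · simp only [sub_add_cancel] at hclt
    rwa [integral_comp_mul_gaussian φ hc₀pos (by positivity) (v := v)] at hclt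
    rw [hv, div_pow, Real.sq_sqrt (by positivity)]
    field_simp
  · refine (hφ.tendsto _).comp ?_
    have := ((tendsto_pow_mfDensity C hk).sub hmean).div_const (Real.sqrt (Nat.factorial ℓ))
    convert this using 2
    · ring
    · ring
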